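/- For every positive integer n, the number of partitions of n satisfies p(n) = −θ_n + Σ_{k=1}^{n−1} (−1)^{k−1} Σ_{α₁=k}^{n−1} Σ_{α₂=k−1}^{α₁−1} ⋯ Σ_{α_k=1}^{α_{k−1}−1} θ_{n−α₁} · θ_{α₁−α₂} ⋯ θ_{α_{k−1}−α_k} · θ_{α_k}, where the k-fold nested sum ranges over strictly decreasing tuples α₁ > α₂ > ⋯ > α_k with k ≤ α₁ ≤ n−1, k−1 ≤ α₂, …, 1 ≤ α_k, and where θ_m = (−1)^j if m = j(3j−1)/2 for some integer j (positive or negative), and θ_m = 0 if m is not a generalized pentagonal number. -/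

import Mathlib

open PowerSeries PowerSeries.WithPiTopology in
/-- The generating function of the partition numbers is the inverse of Euler's function. -/
theorem powerSeriesMk_card_partition_mul_pentagonalSeries :
    (PowerSeries.mk fun n ↦ (Fintype.card (Nat.Partition n) : ℚ)) * pentagonalSeries ℚ = 1 := by
  let _ : TopologicalSpace ℚ := ⊥
  have _ : DiscreteTopology ℚ := ⟨rfl⟩
  have hP := Nat.Partition.hasProd_powerSeriesMk_card_restricted ℚ (fun _ ↦ True)
  have hmul := hP.mul (hasProd_one_sub_X_pow ℚ)
  have hone : (fun i : ℕ ↦ (if True then ∑' j : ℕ, (X : ℚ⟦X⟧) ^ ((i + 1) * j) else 1) *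
      (1 - X ^ (i + 1))) = fun _ ↦ 1 := by
    funext i
    simp only [if_true, pow_mul]
    exact tsum_pow_mul_one_sub_of_constantCoeff_eq_zero (by simp)
  rw [hone] at hmul
  have h := hmul.unique hasProd_one
  simpa [Nat.Partition.restricted] using h

open PowerSeries in
/-- A power of a power series without constant term has coefficients given by sums over strictly
decreasing chains of indices. -/
theorem sum_strictAnti_prod_coeff_eq_coeff_pow {R : Type*} [CommRing R] (A : R⟦X⟧)
    (hA : constantCoeff A = 0) (N r m : ℕ) (hm : m ≤ N) :
    ∑ α ∈ Finset.univ.filter (fun α : Fin (r + 1) → Fin (N + 1) =>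
        StrictAnti α ∧ (α 0 : ℕ) = m ∧ (α (Fin.last r) : ℕ) = 0),
      ∏ i : Fin r, coeff ((α i.castSucc : ℕ) - (α i.succ : ℕ)) A = coeff m (A ^ r) := by
  induction r generalizing m with
  | zero =>
    rw [Finset.sum_filter, ← (Equiv.funUnique (Fin 1) (Fin (N + 1))).symm.sum_comp]
    have hanti (a : Fin (N + 1)) : StrictAnti (uniqueElim a : Fin 1 → Fin (N + 1)) :=
      Subsingleton.strictAnti _
    rw [Finset.sum_eq_single (0 : Fin (N + 1))]
    · simp [coeff_one, hanti, eq_comm]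
    · intro a _ ha
      simp [ha]
    · simp
  | succ r ih =>
    have hcons (a : Fin (N + 1)) (β : Fin (r + 1) → Fin (N + 1)) :
        StrictAnti (Fin.cons a β : Fin (r + 2) → Fin (N + 1)) ↔ β 0 < a ∧ StrictAnti β := by
      rw [Fin.strictAnti_iff_succ_lt, Fin.strictAnti_iff_succ_lt, Fin.forall_fin_succ]
      simp
    have hstep : ∑ α ∈ Finset.univ.filter (fun α : Fin (r + 2) → Fin (N + 1) =>
          StrictAnti α ∧ (α 0 : ℕ) = m ∧ (α (Fin.last (r + 1)) : ℕ) = 0),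
        ∏ i : Fin (r + 1), coeff ((α i.castSucc : ℕ) - (α i.succ : ℕ)) A =
        ∑ x : Fin (N + 1), if (x : ℕ) < m then coeff (m - x) A * coeff x (A ^ r) else 0 := by
      have hx (x : Fin (N + 1)) := ih x (Nat.lt_succ_iff.mp x.2)
      simp_rw [← hx]
      rw [Finset.sum_filter, ← (Fin.consEquiv fun _ : Fin (r + 2) ↦ Fin (N + 1)).sum_comp,
        Fintype.sum_prod_type, Finset.sum_eq_single (⟨m, by omega⟩ : Fin (N + 1))]
      · have hsplit (x : Fin (N + 1)) : (if (x : ℕ) < m then coeff (m - x) A *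
              ∑ β ∈ Finset.univ.filter (fun β : Fin (r + 1) → Fin (N + 1) =>
                StrictAnti β ∧ (β 0 : ℕ) = x ∧ (β (Fin.last r) : ℕ) = 0),
              ∏ i : Fin r, coeff ((β i.castSucc : ℕ) - (β i.succ : ℕ)) A else 0) =
            ∑ β : Fin (r + 1) → Fin (N + 1), if x = β 0 then
              (if (β 0 : ℕ) < m ∧ StrictAnti β ∧ (β (Fin.last r) : ℕ) = 0 then
                coeff (m - β 0) A *
                  ∏ i : Fin r, coeff ((β i.castSucc : ℕ) - (β i.succ : ℕ)) A else 0)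
              else 0 := by
          rw [Finset.sum_filter, Finset.mul_sum]
          split_ifs with hxm
          · refine Finset.sum_congr rfl fun β _ ↦ ?_
            by_cases hβ : x = β 0
            · subst hβ
              simp [hxm]
            · simp [hβ, Fin.val_inj, Ne.symm hβ]
          · refine (Finset.sum_eq_zero fun β _ ↦ ?_).symm
            by_cases hβ : x = β 0
            · subst hβ
              simp [hxm]
            · simp [hβ]
        simp_rw [hsplit]
        rw [Finset.sum_comm]
        refine Finset.sum_congr rfl fun β _ ↦ ?_
        rw [Finset.sum_ite_eq', if_pos (Finset.mem_univ _)]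
        have hanti : StrictAnti (Fin.consEquiv (fun _ : Fin (r + 2) ↦ Fin (N + 1))
            (⟨m, by omega⟩, β)) ↔ (β 0 : ℕ) < m ∧ StrictAnti β := hcons ⟨m, by omega⟩ β
        simp only [hanti, Fin.consEquiv_apply, Fin.cons_zero, Fin.prod_univ_succ, Fin.castSucc_zero,
          Fin.cons_succ, ← Fin.succ_last, ← Fin.succ_castSucc, true_and, and_assoc]
      · intro a _ ha
        refine Finset.sum_eq_zero fun β _ ↦ if_neg fun h ↦ ha (Fin.ext ?_)
        simpa using h.2.1
      · simp
    rw [hstep, Fin.sum_univ_eq_sum_range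
      (fun x ↦ if x < m then coeff (m - x) A * coeff x (A ^ r) else 0), pow_succ', coeff_mul,
      ← Finset.Nat.sum_antidiagonal_swap, Finset.Nat.sum_antidiagonal_eq_sum_range_succ_mk]
    refine (Finset.sum_subset (Finset.range_mono (Nat.succ_le_succ hm)) ?_).symm.trans ?_
    · intro x _ hx
      rw [if_neg]
      simp at hx
      omega
    · refine Finset.sum_congr rfl fun x hx ↦ ?_
      rcases (Nat.lt_succ_iff.mp (Finset.mem_range.mp hx)).lt_or_eq with h | rfl
      · simp [h]
      · simp [hA]


/-- For every positive integer `n`,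
`p(n) = -θ_n + ∑_{k=1}^{n-1} (-1)^{k-1} ∑_{α₁=k}^{n-1} ∑_{α₂=k-1}^{α₁-1} ⋯ ∑_{α_k=1}^{α_{k-1}-1}
  θ_{n-α₁} · θ_{α₁-α₂} ⋯ θ_{α_{k-1}-α_k} · θ_{α_k}`,
where `θ_m = (-1)^j` if `m = j(3j-1)/2` for some `j : ℤ`, and `θ_m = 0` otherwise.

The `k`-fold nested sum over strictly decreasing tuples `n - 1 ≥ α₁ > α₂ > ⋯ > α_k ≥ 1`
(with `αᵢ ≥ k - i + 1`, which is automatic) is encoded as the sum over strictly decreasing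
chains `α : Fin (k + 2) → Fin (n + 1)` with `α 0 = n` and `α (k+1) = 0`, the summand being
the product of `θ` evaluated at the consecutive differences. -/
theorem partition_card_eq_nested_theta_sum (n : ℕ) (hn : 0 < n) (θ : ℕ → ℚ)
    (hθ : ∀ (m : ℕ) (j : ℤ), 2 * (m : ℤ) = j * (3 * j - 1) → θ m = (-1 : ℚ) ^ j)
    (hθ0 : ∀ m : ℕ, (¬ ∃ j : ℤ, 2 * (m : ℤ) = j * (3 * j - 1)) → θ m = 0) :
    (Fintype.card (Nat.Partition n) : ℚ) =
      -θ n + ∑ k ∈ Finset.Icc 1 (n - 1), (-1 : ℚ) ^ (k - 1) *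
        ∑ α ∈ Finset.univ.filter (fun α : Fin (k + 2) → Fin (n + 1) =>
            StrictAnti α ∧ (α 0 : ℕ) = n ∧ (α (Fin.last (k + 1)) : ℕ) = 0),
          ∏ i : Fin (k + 1), θ ((α i.castSucc : ℕ) - (α i.succ : ℕ)) := by
  classical
  have hcoeff (m : ℕ) : PowerSeries.coeff m (PowerSeries.pentagonalSeries ℚ) = θ m := by
    by_cases h : ∃ j : ℤ, 2 * (m : ℤ) = j * (3 * j - 1)
    · obtain ⟨j, hj⟩ := h
      obtain rfl : pentagonal j = m := by
        have := two_mul_natCast_pentagonal j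
        omega
      rw [hθ _ j hj, PowerSeries.coeff_pentagonalSeries_pentagonal]
      rcases Int.even_or_odd j with h | h
      · simp [Int.negOnePow_even j h, h.neg_one_zpow]
      · simp [Int.negOnePow_odd j h, h.neg_one_zpow]
    · rw [hθ0 m h, PowerSeries.coeff_pentagonalSeries_eq_zero]
      rintro ⟨j, rfl⟩
      exact h ⟨j, two_mul_natCast_pentagonal j⟩
  have hθzero : θ 0 = 1 := by simpa using hθ 0 0 (by simp)
  set A : PowerSeries ℚ := PowerSeries.pentagonalSeries ℚ - 1 with hA
  have hA0 : PowerSeries.constantCoeff A = 0 := by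
    rw [← PowerSeries.coeff_zero_eq_constantCoeff_apply]
    rw [hA, map_sub, hcoeff, hθzero, PowerSeries.coeff_zero_one, sub_self]
  have hAcoeff (m : ℕ) (hm : 0 < m) : PowerSeries.coeff m A = θ m := by
    simp [hA, hcoeff, PowerSeries.coeff_one, hm.ne']
  have hP := powerSeriesMk_card_partition_mul_pentagonalSeries
  set P : PowerSeries ℚ := PowerSeries.mk fun n ↦ (Fintype.card (Nat.Partition n) : ℚ) with hPdef
  have hgeom : P = ∑ r ∈ Finset.range (n + 1), (-A) ^ r + P * (-A) ^ (n + 1) := by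
    have h := mul_neg_geom_sum (-A) (n + 1)
    have h1 : 1 - -A = PowerSeries.pentagonalSeries ℚ := by rw [hA]; ring
    rw [h1] at h
    linear_combination -P * h + (∑ r ∈ Finset.range (n + 1), (-A) ^ r) * hP
  have htail : PowerSeries.coeff n (P * (-A) ^ (n + 1)) = 0 := by
    have hdvd : (PowerSeries.X : PowerSeries ℚ) ^ (n + 1) ∣ P * (-A) ^ (n + 1) :=
      Dvd.dvd.mul_left (pow_dvd_pow_of_dvd (PowerSeries.X_dvd_iff.mpr (by simp [hA0])) _) _
    exact PowerSeries.X_pow_dvd_iff.mp hdvd n n.lt_succ_self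
  have hsum (r : ℕ) := sum_strictAnti_prod_coeff_eq_coeff_pow A hA0 n r n le_rfl
  have hchain (k : ℕ) : ∑ α ∈ Finset.univ.filter (fun α : Fin (k + 2) → Fin (n + 1) =>
            StrictAnti α ∧ (α 0 : ℕ) = n ∧ (α (Fin.last (k + 1)) : ℕ) = 0),
          ∏ i : Fin (k + 1), θ ((α i.castSucc : ℕ) - (α i.succ : ℕ)) =
        PowerSeries.coeff n (A ^ (k + 1)) := by
    rw [← hsum (k + 1)]
    refine Finset.sum_congr (by congr) fun α hα ↦ Finset.prod_congr rfl fun i _ ↦ ?_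
    have hlt := (Finset.mem_filter.mp hα).2.1 (Fin.castSucc_lt_succ (i := i))
    exact (hAcoeff _ (Nat.sub_pos_of_lt hlt)).symm
  simp_rw [hchain]
  have hcard : (Fintype.card (Nat.Partition n) : ℚ) =
      ∑ r ∈ Finset.range (n + 1), (-1) ^ r * PowerSeries.coeff n (A ^ r) := by
    have h := congrArg (PowerSeries.coeff n) hgeom
    rw [map_add, htail, add_zero, map_sum, hPdef, PowerSeries.coeff_mk] at h
    rw [h]
    refine Finset.sum_congr rfl fun r _ ↦ ?_
    rw [neg_pow, ← map_one PowerSeries.C, ← map_neg, ← map_pow, PowerSeries.coeff_C_mul]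
  obtain ⟨n, rfl⟩ : ∃ l, n = l + 1 := ⟨n - 1, by omega⟩
  rw [hcard, Finset.sum_range_succ', Finset.sum_range_succ', ← hAcoeff _ hn,
    ← Finset.Ico_add_one_right_eq_Icc, Finset.sum_Ico_eq_sum_range]
  simp [PowerSeries.coeff_one, pow_add, add_comm]
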